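/- Order of the normalizer of a stabilizer: Let S be an abelian subgroup of the n-qubit Pauli group 𝒫ₙ with −1 ∉ S and |S| = 2^{n−k} (where 0 ≤ k ≤ n). Then the normalizer N(S) of S in 𝒫ₙ has order 4 · 2^{n+k} = 2^{n+k+2}, and consequently the quotient group N(S)/S has order 4^{k+1}. -/

import Mathlib

open Matrix Finset

noncomputable section

/-- The space of `2^n × 2^n` complex matrices, realized as matrices indexed by
`n`-bit strings (the `n`-fold Kronecker product of `M₂(ℂ)`). -/
abbrev MatN (n : ℕ) := Matrix (Fin n → Fin 2) (Fin n → Fin 2) ℂ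

/-- The Pauli matrix `X`. -/
def PX : Matrix (Fin 2) (Fin 2) ℂ := !![0, 1; 1, 0]

/-- The Pauli matrix `Y`. -/
def PY : Matrix (Fin 2) (Fin 2) ℂ := !![0, -Complex.I; Complex.I, 0]

/-- The Pauli matrix `Z`. -/
def PZ : Matrix (Fin 2) (Fin 2) ℂ := !![1, 0; 0, -1]

/-- A single-qubit Pauli matrix: one of `1, X, Y, Z`. -/
def IsSinglePauli (σ : Matrix (Fin 2) (Fin 2) ℂ) : Prop :=
  σ = 1 ∨ σ = PX ∨ σ = PY ∨ σ = PZ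

/-- The Kronecker (tensor) product `σ₁ ⊗ ⋯ ⊗ σₙ` of single-qubit matrices, with entries
`(⊗ⱼ σⱼ) x y = ∏ⱼ (σⱼ) (x j) (y j)`. -/
def tensorPauli {n : ℕ} (σ : Fin n → Matrix (Fin 2) (Fin 2) ℂ) : MatN n :=
  Matrix.of fun x y => ∏ j, σ j (x j) (y j)

/-- An `n`-qubit Pauli operator: `i^c • σ₁ ⊗ ⋯ ⊗ σₙ` with `c ∈ {0,1,2,3}` and each
`σⱼ ∈ {1, X, Y, Z}`. -/
def IsPauli (n : ℕ) (P : MatN n) : Prop :=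
  ∃ (c : ℕ) (σ : Fin n → Matrix (Fin 2) (Fin 2) ℂ),
    c < 4 ∧ (∀ j, IsSinglePauli (σ j)) ∧ P = Complex.I ^ c • tensorPauli σ

/-- An `n`-qubit Pauli operator of weight at most `w`: at most `w` of the tensor factors
are different from the identity. -/
def IsPauliOfWeightLE (n w : ℕ) (P : MatN n) : Prop :=
  ∃ (c : ℕ) (σ : Fin n → Matrix (Fin 2) (Fin 2) ℂ),
    c < 4 ∧ (∀ j, IsSinglePauli (σ j)) ∧ Nat.card {j // σ j ≠ 1} ≤ w ∧
      P = Complex.I ^ c • tensorPauli σ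

/-- The weight of an `n`-qubit Pauli operator: the number of tensor factors which are not
the identity (defined as an infimum over representations). -/
def pauliWeight {n : ℕ} (P : MatN n) : ℕ :=
  sInf {w | ∃ (c : ℕ) (σ : Fin n → Matrix (Fin 2) (Fin 2) ℂ),
    c < 4 ∧ (∀ j, IsSinglePauli (σ j)) ∧ Nat.card {j // σ j ≠ 1} = w ∧
      P = Complex.I ^ c • tensorPauli σ}

/-- The code space `T(S)` of a set `S` of matrices: the states fixed by every `M ∈ S`. -/
def codeSpace {n : ℕ} (S : Set (MatN n)) : Submodule ℂ ((Fin n → Fin 2) → ℂ) where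
  carrier := {ψ | ∀ M ∈ S, M.mulVec ψ = ψ}
  add_mem' := by
    intro ψ φ hψ hφ M hM
    rw [Matrix.mulVec_add, hψ M hM, hφ M hM]
  zero_mem' := by
    intro M hM
    rw [Matrix.mulVec_zero]
  smul_mem' := by
    intro c ψ hψ M hM
    rw [Matrix.mulVec_smul, hψ M hM]

/-- An `[[n,k,d]]` quantum code: a subspace of `ℂ^{2^n}` of dimension `2^k` such that no
`n`-qubit Pauli operator of weight at most `d−1` can distinguish codewords, i.e.
`⟪ψ, E ψ⟫` is constant over unit vectors `ψ` in the code. -/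
def IsQuantumCode (n k d : ℕ) (C : Submodule ℂ ((Fin n → Fin 2) → ℂ)) : Prop :=
  Module.finrank ℂ C = 2 ^ k ∧
  ∀ E : MatN n, IsPauliOfWeightLE n (d - 1) E →
    ∃ cE : ℂ, ∀ ψ ∈ C, star ψ ⬝ᵥ ψ = 1 → star ψ ⬝ᵥ E.mulVec ψ = cE

theorem tensorPauli_mul {n : ℕ} (σ τ : Fin n → Matrix (Fin 2) (Fin 2) ℂ) :
    tensorPauli σ * tensorPauli τ = tensorPauli (fun j => σ j * τ j) := by
  ext x y
  simp only [tensorPauli, Matrix.mul_apply, Matrix.of_apply, ← Finset.prod_mul_distrib]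
  rw [Finset.prod_univ_sum, Fintype.piFinset_univ]

theorem tensorPauli_one {n : ℕ} :
    tensorPauli (fun _ : Fin n => (1 : Matrix (Fin 2) (Fin 2) ℂ)) = 1 := by
  ext x y
  simp only [tensorPauli, Matrix.of_apply, Matrix.one_apply, Finset.prod_ite_zero,
    Finset.mem_univ, true_implies, Finset.prod_const_one, funext_iff]

theorem tensorPauli_smul {n : ℕ} (c : Fin n → ℂ) (σ : Fin n → Matrix (Fin 2) (Fin 2) ℂ) :
    tensorPauli (fun j => c j • σ j) = (∏ j, c j) • tensorPauli σ := by
  ext x y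
  simp [tensorPauli, Finset.prod_mul_distrib]

theorem trace_tensorPauli {n : ℕ} (σ : Fin n → Matrix (Fin 2) (Fin 2) ℂ) :
    (tensorPauli σ).trace = ∏ j, (σ j).trace := by
  simp only [Matrix.trace, Matrix.diag_apply, tensorPauli, Matrix.of_apply]
  rw [Finset.prod_univ_sum, Fintype.piFinset_univ]

/-- The four single-qubit Pauli matrices `1, X, Y, Z`, indexed by `Fin 4`. -/
def singlePauli : Fin 4 → Matrix (Fin 2) (Fin 2) ℂ := ![1, PX, PY, PZ]

theorem isSinglePauli_iff (σ : Matrix (Fin 2) (Fin 2) ℂ) :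
    IsSinglePauli σ ↔ ∃ a, singlePauli a = σ := by
  simp [Fin.exists_fin_succ, singlePauli, IsSinglePauli, eq_comm]

theorem singlePauli_mul_self (a : Fin 4) : singlePauli a * singlePauli a = 1 := by
  fin_cases a <;> ext i j <;> fin_cases i <;> fin_cases j <;>
    simp [singlePauli, PX, PY, PZ, Matrix.mul_apply]

theorem singlePauli_mul (a b : Fin 4) :
    ∃ (c : ℕ) (d : Fin 4), singlePauli a * singlePauli b = Complex.I ^ c • singlePauli d := by
  have hxy : PX * PY = Complex.I ^ 1 • PZ := by
    ext i j; fin_cases i <;> fin_cases j <;> simp [PX, PY, PZ]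
  have hyx : PY * PX = Complex.I ^ 3 • PZ := by
    ext i j; fin_cases i <;> fin_cases j <;> simp [PX, PY, PZ]
  have hyz : PY * PZ = Complex.I ^ 1 • PX := by
    ext i j; fin_cases i <;> fin_cases j <;> simp [PX, PY, PZ]
  have hzy : PZ * PY = Complex.I ^ 3 • PX := by
    ext i j; fin_cases i <;> fin_cases j <;> simp [PX, PY, PZ]
  have hzx : PZ * PX = Complex.I ^ 1 • PY := by
    ext i j; fin_cases i <;> fin_cases j <;> simp [PX, PY, PZ]
  have hxz : PX * PZ = Complex.I ^ 3 • PY := by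
    ext i j; fin_cases i <;> fin_cases j <;> simp [PX, PY, PZ]
  by_cases hab : a = b
  · exact ⟨0, 0, by rw [hab, singlePauli_mul_self]; simp [singlePauli]⟩
  by_cases ha : a = 0
  · exact ⟨0, b, by simp [ha, singlePauli]⟩
  by_cases hb : b = 0
  · exact ⟨0, a, by simp [hb, singlePauli]⟩
  fin_cases a <;> fin_cases b <;> first
    | exact absurd rfl hab
    | exact absurd rfl ha
    | exact absurd rfl hb
    | exact ⟨1, 3, hxy⟩
    | exact ⟨3, 3, hyx⟩
    | exact ⟨1, 1, hyz⟩
    | exact ⟨3, 1, hzy⟩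
    | exact ⟨1, 2, hzx⟩
    | exact ⟨3, 2, hxz⟩

theorem singlePauli_mul_comm_or_neg (a b : Fin 4) :
    ∃ e : ℂ, (e = 1 ∨ e = -1) ∧
      singlePauli a * singlePauli b = e • (singlePauli b * singlePauli a) := by
  by_cases h : a = b ∨ a = 0 ∨ b = 0
  · refine ⟨1, .inl rfl, ?_⟩
    rcases h with rfl | rfl | rfl <;> simp [singlePauli]
  · refine ⟨-1, .inr rfl, ?_⟩
    fin_cases a <;> fin_cases b <;> first
      | exact absurd (by decide) h
      | (ext i j; fin_cases i <;> fin_cases j <;> simp [singlePauli, PX, PY, PZ])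

theorem exists_singlePauli_anticommute {a : Fin 4} (ha : a ≠ 0) :
    ∃ b, singlePauli b * singlePauli a = (-1 : ℂ) • (singlePauli a * singlePauli b) := by
  fin_cases a
  · exact absurd rfl ha
  · exact ⟨2, by ext i j; fin_cases i <;> fin_cases j <;> simp [singlePauli, PX, PY]⟩
  · exact ⟨1, by ext i j; fin_cases i <;> fin_cases j <;> simp [singlePauli, PX, PY]⟩
  · exact ⟨1, by ext i j; fin_cases i <;> fin_cases j <;> simp [singlePauli, PX, PZ]⟩

theorem trace_singlePauli_mul (a b : Fin 4) :
    (singlePauli a * singlePauli b).trace = if a = b then 2 else 0 := by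
  by_cases h : a = b
  · subst h
    simp [singlePauli_mul_self]
  · rw [if_neg h]
    fin_cases a <;> fin_cases b <;> first
      | exact absurd rfl h
      | simp [singlePauli, PX, PY, PZ, Matrix.trace_fin_two]

/-- The Pauli operator `i^c · σ₁ ⊗ ⋯ ⊗ σₙ`, with the factors given by their indices. -/
def pauliOp {n : ℕ} (c : ℕ) (a : Fin n → Fin 4) : MatN n :=
  Complex.I ^ c • tensorPauli (fun j => singlePauli (a j))

theorem I_pow_mod_four (c : ℕ) : Complex.I ^ (c % 4) = Complex.I ^ c := by
  conv_rhs => rw [← Nat.mod_add_div c 4, pow_add, pow_mul, Complex.I_pow_four, one_pow, mul_one]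

theorem isPauli_iff {n : ℕ} (P : MatN n) : IsPauli n P ↔ ∃ c a, P = pauliOp c a := by
  constructor
  · rintro ⟨c, σ, -, hσ, rfl⟩
    choose a ha using fun j => (isSinglePauli_iff _).1 (hσ j)
    exact ⟨c, a, by simp only [pauliOp, ha]⟩
  · rintro ⟨c, a, rfl⟩
    exact ⟨c % 4, _, Nat.mod_lt _ (by norm_num), fun j => (isSinglePauli_iff _).2 ⟨a j, rfl⟩,
      by rw [I_pow_mod_four, pauliOp]⟩

theorem pauliOp_mul {n : ℕ} (c d : ℕ) (a b : Fin n → Fin 4) :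
    ∃ e f, pauliOp c a * pauliOp d b = pauliOp e f := by
  choose e f h using fun j => singlePauli_mul (a j) (b j)
  refine ⟨c + d + ∑ j, e j, f, ?_⟩
  simp only [pauliOp, smul_mul_smul_comm, tensorPauli_mul, h, tensorPauli_smul, smul_smul,
    Finset.prod_pow_eq_pow_sum, pow_add]

theorem pauliOp_mul_self {n : ℕ} (c d : ℕ) (a : Fin n → Fin 4) :
    pauliOp c a * pauliOp d a = Complex.I ^ (c + d) • (1 : MatN n) := by
  simp only [pauliOp, smul_mul_smul_comm, tensorPauli_mul, singlePauli_mul_self,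
    tensorPauli_one, pow_add]

theorem pauliOp_mul_inv {n : ℕ} (c : ℕ) (a : Fin n → Fin 4) :
    pauliOp c a * pauliOp (3 * c) a = 1 := by
  rw [pauliOp_mul_self, show c + 3 * c = 4 * c by ring, pow_mul, Complex.I_pow_four, one_pow,
    one_smul]

theorem pauliOp_inv_mul {n : ℕ} (c : ℕ) (a : Fin n → Fin 4) :
    pauliOp (3 * c) a * pauliOp c a = 1 := by
  rw [pauliOp_mul_self, show 3 * c + c = 4 * c by ring, pow_mul, Complex.I_pow_four, one_pow,
    one_smul]

theorem pauliOp_zero {n : ℕ} (c : ℕ) :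
    pauliOp c (fun _ : Fin n => 0) = Complex.I ^ c • (1 : MatN n) := by
  rw [pauliOp, ← tensorPauli_one]
  rfl

theorem pauliOp_mul_comm_or_neg {n : ℕ} (c d : ℕ) (a b : Fin n → Fin 4) :
    pauliOp c a * pauliOp d b = pauliOp d b * pauliOp c a ∨
      pauliOp c a * pauliOp d b = -(pauliOp d b * pauliOp c a) := by
  choose e he h using fun j => singlePauli_mul_comm_or_neg (a j) (b j)
  have hprod : (∏ j, e j) = 1 ∨ (∏ j, e j) = -1 := by
    refine Finset.prod_induction e (fun z => z = 1 ∨ z = -1) ?_ (.inl rfl) fun j _ => he j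
    rintro x y (rfl | rfl) (rfl | rfl) <;> simp
  have key : pauliOp c a * pauliOp d b = (∏ j, e j) • (pauliOp d b * pauliOp c a) := by
    simp only [pauliOp, smul_mul_smul_comm, tensorPauli_mul, h, tensorPauli_smul, smul_smul]
    congr 1
    ring
  rcases hprod with h' | h' <;> rw [key, h'] <;> simp

theorem exists_pauliOp_anticommute {n : ℕ} (c : ℕ) {a : Fin n → Fin 4} (ha : a ≠ fun _ => 0) :
    ∃ b, pauliOp 0 b * pauliOp c a = -(pauliOp c a * pauliOp 0 b) := by
  obtain ⟨j, hj⟩ := Function.ne_iff.1 ha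
  obtain ⟨r, hr⟩ := exists_singlePauli_anticommute hj
  refine ⟨Pi.single j r, ?_⟩
  have h : ∀ i, singlePauli ((Pi.single j r : Fin n → Fin 4) i) * singlePauli (a i) =
      (if i = j then (-1 : ℂ) else 1) •
        (singlePauli (a i) * singlePauli ((Pi.single j r : Fin n → Fin 4) i)) := by
    intro i
    by_cases hi : i = j
    · subst hi
      simpa using hr
    · simp [hi, singlePauli]
  simp only [pauliOp, smul_mul_smul_comm, tensorPauli_mul, h, tensorPauli_smul]
  simp

theorem I_pow_injOn {c d : ℕ} (hc : c < 4) (hd : d < 4) (h : Complex.I ^ c = Complex.I ^ d) :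
    c = d := by
  interval_cases c <;> interval_cases d <;> simp [Complex.ext_iff, pow_succ] at h ⊢ <;>
    norm_num at h

theorem pauliOp_injective {n : ℕ} {c d : ℕ} {a b : Fin n → Fin 4} (hc : c < 4) (hd : d < 4)
    (h : pauliOp c a = pauliOp d b) : c = d ∧ a = b := by
  have htr := congrArg (fun M => (M * pauliOp 0 b).trace) h
  simp only [pauliOp, smul_mul_smul_comm, tensorPauli_mul, Matrix.trace_smul, trace_tensorPauli,
    trace_singlePauli_mul, pow_zero, mul_one, if_true, Finset.prod_const, smul_eq_mul] at htr
  have hab : a = b := by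
    by_contra hne
    obtain ⟨j, hj⟩ := Function.ne_iff.1 hne
    rw [Finset.prod_eq_zero (Finset.mem_univ j) (if_neg hj), mul_zero] at htr
    exact mul_ne_zero (pow_ne_zero _ Complex.I_ne_zero) (pow_ne_zero _ two_ne_zero) htr.symm
  subst hab
  simp only [if_true, Finset.prod_const] at htr
  exact ⟨I_pow_injOn hc hd (mul_right_cancel₀ (pow_ne_zero _ two_ne_zero) htr), rfl⟩

/-- The Pauli operator `pauliOp c a` as an invertible matrix. -/
def pauliUnit {n : ℕ} (c : ℕ) (a : Fin n → Fin 4) : (MatN n)ˣ :=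
  ⟨pauliOp c a, pauliOp (3 * c) a, pauliOp_mul_inv c a, pauliOp_inv_mul c a⟩

theorem val_pauliUnit {n : ℕ} (c : ℕ) (a : Fin n → Fin 4) :
    (pauliUnit c a : MatN n) = pauliOp c a :=
  rfl

/-- The `n`-qubit Pauli group `𝒫ₙ`. -/
def pauliGroup (n : ℕ) : Subgroup (MatN n)ˣ where
  carrier := {P | IsPauli n (P : MatN n)}
  one_mem' := (isPauli_iff _).2 ⟨0, fun _ => 0, by simp [pauliOp_zero]⟩
  mul_mem' := by
    intro P Q hP hQ
    obtain ⟨c, a, h⟩ := (isPauli_iff _).1 hP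
    obtain ⟨d, b, h'⟩ := (isPauli_iff _).1 hQ
    exact (isPauli_iff _).2 (by rw [Units.val_mul, h, h']; exact pauliOp_mul c d a b)
  inv_mem' := by
    intro P hP
    obtain ⟨c, a, h⟩ := (isPauli_iff _).1 hP
    obtain rfl : P = pauliUnit c a := Units.ext h
    exact (isPauli_iff _).2 ⟨3 * c, a, rfl⟩

theorem exists_pauliUnit_eq {n : ℕ} {P : (MatN n)ˣ} (hP : P ∈ pauliGroup n) :
    ∃ c a, P = pauliUnit c a := by
  obtain ⟨c, a, h⟩ := (isPauli_iff _).1 hP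
  exact ⟨c, a, Units.ext h⟩

theorem pauliUnit_mem {n : ℕ} (c : ℕ) (a : Fin n → Fin 4) : pauliUnit c a ∈ pauliGroup n :=
  (isPauli_iff _).2 ⟨c, a, rfl⟩

theorem card_pauliGroup (n : ℕ) : Nat.card (pauliGroup n) = 4 ^ (n + 1) := by
  have hbij : Function.Bijective fun p : Fin 4 × (Fin n → Fin 4) =>
      (⟨pauliUnit p.1 p.2, pauliUnit_mem _ _⟩ : pauliGroup n) := by
    constructor
    · rintro ⟨c, a⟩ ⟨d, b⟩ h
      have h' : pauliOp (c : ℕ) a = pauliOp (d : ℕ) b :=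
        congrArg (fun P : pauliGroup n => ((P : (MatN n)ˣ) : MatN n)) h
      obtain ⟨hc, ha⟩ := pauliOp_injective c.2 d.2 h'
      exact Prod.ext (Fin.ext hc) ha
    · rintro ⟨P, hP⟩
      obtain ⟨c, a, rfl⟩ := exists_pauliUnit_eq hP
      refine ⟨(⟨c % 4, Nat.mod_lt _ (by norm_num)⟩, a), Subtype.ext (Units.ext ?_)⟩
      simp only [pauliUnit, pauliOp, I_pow_mod_four]
  rw [← Nat.card_eq_of_bijective _ hbij]
  simp [pow_succ, mul_comm]

theorem sum_eq_zero_of_mul_right_neg {G : Type*} [Group G] [Fintype G] (f : G → ℤ) (r : G)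
    (h : ∀ g, f (g * r) = -f g) : ∑ g, f g = 0 := by
  have := Fintype.sum_equiv (Equiv.mulRight r) (fun g => f (g * r)) f fun _ => rfl
  simp only [h, Finset.sum_neg_distrib] at this
  linarith

/-- In a finite group whose commutators all lie in `{1, z}` with `z` a central involution, a
subgroup meeting the center trivially satisfies `|C(S)| · |S| = |G|`. -/
theorem card_centralizer_mul_card {G : Type*} [Group G] [Finite G] {z : G} (hz : z * z = 1)
    (hzc : ∀ g, z * g = g * z) (hcomm : ∀ g h : G, g * h = h * g ∨ g * h = z * (h * g))
    (S : Subgroup G) (hS : ∀ s ∈ S, (∀ g, g * s = s * g) → s = 1) :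
    Nat.card {g : G // ∀ s ∈ S, g * s = s * g} * Nat.card S = Nat.card G := by
  classical
  have := Fintype.ofFinite G
  have := Fintype.ofFinite S
  let χ : G → G → ℤ := fun g h => if g * h = h * g then 1 else -1
  have χ_symm (g h : G) : χ g h = χ h g := by simp only [χ, eq_comm]
  have χ_mul {r h : G} (hr : r * h ≠ h * r) (g : G) : χ (g * r) h = -χ g h := by
    have hr' : r * h = z * (h * r) := (hcomm r h).resolve_left hr
    have hz1 : z ≠ 1 := fun h1 => hr (by rw [hr', h1, one_mul])
    have e : g * r * h = z * (g * h) * r := by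
      rw [mul_assoc, hr', ← mul_assoc, ← hzc]
      simp only [mul_assoc]
    by_cases hg : g * h = h * g
    · have : g * r * h ≠ h * (g * r) := by
        rw [e, hg]
        intro h2
        exact hz1 (by simpa [mul_assoc] using h2)
      simp only [χ, if_pos hg, if_neg this]
    · have : g * r * h = h * (g * r) := by
        rw [e, (hcomm g h).resolve_left hg, ← mul_assoc z, hz, one_mul, mul_assoc]
      simp only [χ, if_neg hg, if_pos this, neg_neg]
  have row (g : G) : ∑ s : S, χ g s =
      if ∀ s ∈ S, g * s = s * g then (Nat.card S : ℤ) else 0 := by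
    split_ifs with hg
    · rw [Finset.sum_congr rfl fun (s : S) _ => if_pos (hg s s.2)]
      simp
    · push Not at hg
      obtain ⟨r, hrS, hr⟩ := hg
      refine sum_eq_zero_of_mul_right_neg _ ⟨r, hrS⟩ fun s => ?_
      rw [χ_symm, χ_symm g]
      exact χ_mul hr.symm s
  have col (s : S) : ∑ g : G, χ g s = if s = 1 then (Nat.card G : ℤ) else 0 := by
    split_ifs with hs
    · simp [hs, χ]
    · have : ¬ ∀ g, g * (s : G) = s * g := fun h => hs (Subtype.ext (hS s s.2 h))
      push Not at this
      obtain ⟨r, hr⟩ := this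
      exact sum_eq_zero_of_mul_right_neg _ r (χ_mul hr)
  have key := Finset.sum_comm (s := Finset.univ) (t := Finset.univ)
    (f := fun (g : G) (s : S) => χ g s)
  simp only [row, col] at key
  rw [← Finset.sum_filter, Finset.sum_const, Finset.sum_ite_eq', if_pos (Finset.mem_univ _),
    nsmul_eq_mul] at key
  rw [Nat.card_eq_fintype_card (α := {g : G // ∀ s ∈ S, g * s = s * g}), Fintype.card_subtype]
  exact_mod_cast key

theorem eq_one_of_commute_pauliGroup {n : ℕ} {P : (MatN n)ˣ} {S : Subgroup (MatN n)ˣ}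
    (hneg : (-1 : (MatN n)ˣ) ∉ S) (hPS : P ∈ S) (hP : P ∈ pauliGroup n)
    (hcomm : ∀ R ∈ pauliGroup n, R * P = P * R) : P = 1 := by
  obtain ⟨c, a, rfl⟩ := exists_pauliUnit_eq hP
  have ha : a = fun _ => 0 := by
    by_contra ha
    obtain ⟨b, hb⟩ := exists_pauliOp_anticommute c ha
    have h : pauliOp 0 b * pauliOp c a = pauliOp c a * pauliOp 0 b :=
      congrArg Units.val (hcomm _ (pauliUnit_mem 0 b))
    have h0 : ((pauliUnit c a * pauliUnit 0 b : (MatN n)ˣ) : MatN n) = 0 :=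
      Matrix.ext fun x y => self_eq_neg.1 (congrFun₂ (h.symm.trans hb) x y)
    exact Units.ne_zero _ h0
  subst ha
  have hval (m : ℕ) : ((pauliUnit c (fun _ : Fin n => 0) ^ m : (MatN n)ˣ) : MatN n) =
      Complex.I ^ (c * m) • 1 := by
    rw [Units.val_pow_eq_pow_val, val_pauliUnit, pauliOp_zero, smul_pow, one_pow, pow_mul]
  have hI : Complex.I ^ c = 1 := by
    have hlt : c % 4 < 4 := Nat.mod_lt _ (by norm_num)
    have hmod := I_pow_mod_four c
    interval_cases c % 4
    · simpa using hmod.symm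
    · refine absurd ?_ hneg
      convert S.pow_mem hPS 2
      ext1
      rw [hval, pow_mul, ← hmod]
      simp
    · refine absurd ?_ hneg
      convert S.pow_mem hPS 1
      ext1
      rw [hval, pow_mul, ← hmod]
      simp
    · refine absurd ?_ hneg
      convert S.pow_mem hPS 2
      ext1
      rw [hval, pow_mul, ← hmod]
      simp
  ext1
  simpa [hI] using hval 1

theorem card_pauliNormalizer_mul_card {n : ℕ} (S : Subgroup (MatN n)ˣ)
    (hPauli : ∀ P ∈ S, IsPauli n (P : MatN n)) (hneg : (-1 : (MatN n)ˣ) ∉ S) :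
    Nat.card {P : (MatN n)ˣ // IsPauli n (P : MatN n) ∧ ∀ Q ∈ S, P * Q = Q * P} * Nat.card S
      = 4 ^ (n + 1) := by
  have hle : S ≤ pauliGroup n := hPauli
  have : Finite (pauliGroup n) := Nat.finite_of_card_ne_zero (by simp [card_pauliGroup])
  have hneg_mem : (-1 : (MatN n)ˣ) ∈ pauliGroup n :=
    (isPauli_iff _).2 ⟨2, fun _ => 0, by simp [pauliOp_zero]⟩
  have key := card_centralizer_mul_card (z := (⟨-1, hneg_mem⟩ : pauliGroup n))
    (Subtype.ext (by simp)) (fun g => Subtype.ext (by simp)) ?_ (S.subgroupOf (pauliGroup n)) ?_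
  · rw [card_pauliGroup, Nat.card_congr (Subgroup.subgroupOfEquivOfLe hle).toEquiv] at key
    rw [← key]
    congr 1
    refine Nat.card_congr ((Equiv.subtypeSubtypeEquivSubtypeInter
      (fun P => P ∈ pauliGroup n) (fun P => ∀ Q ∈ S, P * Q = Q * P)).symm.trans
      (Equiv.subtypeEquivRight fun P => ?_))
    exact ⟨fun h s hs => Subtype.ext (h s hs),
      fun h Q hQ => congrArg Subtype.val (h ⟨Q, hle hQ⟩ hQ)⟩
  · rintro ⟨P, hP⟩ ⟨Q, hQ⟩
    obtain ⟨c, a, rfl⟩ := exists_pauliUnit_eq hP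
    obtain ⟨d, b, rfl⟩ := exists_pauliUnit_eq hQ
    refine (pauliOp_mul_comm_or_neg c d a b).imp (fun h => Subtype.ext (Units.ext h))
      fun h => Subtype.ext (Units.ext ?_)
    simpa [val_pauliUnit] using h
  · rintro ⟨P, hP⟩ hPS hc
    exact Subtype.ext (eq_one_of_commute_pauliGroup hneg hPS hP
      fun R hR => congrArg Subtype.val (hc ⟨R, hR⟩))

/-- **Order of the normalizer of a stabilizer.**  Let `S` be an abelian subgroup of the
`n`-qubit Pauli group with `−1 ∉ S` and `|S| = 2^{n−k}` (`k ≤ n`).  Then the normalizer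
(= centralizer) `N(S)` of `S` in the Pauli group has order `2^{n+k+2} = 4 · 2^{n+k}`;
consequently (by Lagrange's theorem) the quotient group `N(S)/S` has order
`4^{k+1} = |N(S)| / |S|`. -/
theorem normalizer_order (n k : ℕ) (hk : k ≤ n)
    (S : Subgroup (MatN n)ˣ)
    (hPauli : ∀ P ∈ S, IsPauli n (P : MatN n))
    (hab : ∀ P ∈ S, ∀ Q ∈ S, P * Q = Q * P)
    (hneg : (-1 : (MatN n)ˣ) ∉ S)
    (hcard : Nat.card S = 2 ^ (n - k)) :
    Nat.card {P : (MatN n)ˣ // IsPauli n (P : MatN n) ∧ ∀ Q ∈ S, P * Q = Q * P}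
      = 2 ^ (n + k + 2) ∧
    Nat.card {P : (MatN n)ˣ // IsPauli n (P : MatN n) ∧ ∀ Q ∈ S, P * Q = Q * P}
      = 4 ^ (k + 1) * Nat.card S := by
  have hmul := card_pauliNormalizer_mul_card S hPauli hneg
  have hN : Nat.card {P : (MatN n)ˣ // IsPauli n (P : MatN n) ∧ ∀ Q ∈ S, P * Q = Q * P}
      = 2 ^ (n + k + 2) := by
    refine Nat.eq_of_mul_eq_mul_right (pow_pos two_pos (n - k)) ?_
    rw [← hcard, hmul, hcard, ← pow_add, show 4 = 2 ^ 2 by rfl, ← pow_mul]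
    congr 1
    omega
  refine ⟨hN, ?_⟩
  rw [hN, hcard, show 4 = 2 ^ 2 by rfl, ← pow_mul, ← pow_add]
  congr 1
  omega

end
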